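/- arXiv:2202.11894 — 4 statements merged into one kernel-verified Lean document; each statement's English description precedes it below -/
import Mathlib

section
/- Let (g,⟨·,·⟩) be a unimodular metric Lie algebra with dim g = 4, and suppose the inner product is not bi-invariant, i.e. there exists X₀ ∈ g such that ad_{X₀} is not skew-adjoint with respect to ⟨·,·⟩ (for unimodular g of dimension 4 this holds exactly when g is neither abelian nor isomorphic to so(3) ⊕ ℝ with a bi-invariant inner product). Then the Euler equation has an unstable stationary point. -/
open scoped InnerProductSpace

/-- A Lie algebra structure (a bilinear Lie bracket) on the real inner product space `g`,
making `(g, ⟨·,·⟩)` a metric Lie algebra. -/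
structure LieStructure (g : Type*) [NormedAddCommGroup g] [InnerProductSpace ℝ g] where
  bracket : g →ₗ[ℝ] g →ₗ[ℝ] g
  bracket_self : ∀ x, bracket x x = 0
  jacobi : ∀ x y z, bracket x (bracket y z) + bracket y (bracket z x) + bracket z (bracket x y) = 0

namespace LieStructure

variable {g : Type*} [NormedAddCommGroup g] [InnerProductSpace ℝ g] [FiniteDimensional ℝ g]
variable (L : LieStructure g)

/-- `ad_Y : Z ↦ [Y, Z]`. -/
def ad (Y : g) : g →ₗ[ℝ] g := L.bracket Y

/-- `ad_Yᵗ`, the adjoint of `ad_Y` with respect to the inner product. -/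
noncomputable def adT (Y : g) : g →ₗ[ℝ] g := LinearMap.adjoint (L.ad Y)

/-- A solution of the Euler equation `Ẏ = ad_Yᵗ Y`. -/
def IsSolution (Y : ℝ → g) : Prop := ∀ t : ℝ, HasDerivAt Y (L.adT (Y t) (Y t)) t

/-- A stationary point (equilibrium) of the Euler equation: `ad_Xᵗ X = 0`. -/
def IsStationary (X : g) : Prop := L.adT X X = 0

/-- Lyapunov stability of a point `X` for the Euler equation: every solution starting
close to `X` remains close to `X` for all `t ≥ 0`. -/
def IsStable (X : g) : Prop :=
  ∀ ε > 0, ∃ δ > 0, ∀ Y : ℝ → g, L.IsSolution Y → ‖Y 0 - X‖ < δ → ∀ t ≥ 0, ‖Y t - X‖ < ε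

/-- The linearisation `J_X : Y ↦ ad_Xᵗ Y + ad_Yᵗ X` of the Euler equation at `X`. -/
noncomputable def J (X : g) : g →ₗ[ℝ] g where
  toFun Y := L.adT X Y + L.adT Y X
  map_add' Y Z := by
    simp only [adT, ad, map_add, LinearMap.add_apply]
    abel
  map_smul' c Y := by
    simp only [adT, ad, map_smul, map_smulₛₗ, starRingEnd_apply, star_trivial,
      LinearMap.smul_apply, RingHom.id_apply, smul_add]

/-- `g` is unimodular: `Tr (ad_X) = 0` for all `X`. -/
def IsUnimodular : Prop := ∀ X : g, LinearMap.trace ℝ g (L.ad X) = 0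

/-- The centre of `g`: the set of `X` with `[X, ·] = 0`. -/
def center : Submodule ℝ g := LinearMap.ker L.bracket

end LieStructure

/-- `σ_k(J)`: the `k`-th elementary symmetric function of the eigenvalues of `J`, i.e.
`(-1)^k` times the coefficient of `λ^(n-k)` in the characteristic polynomial
`det (λ·id - J)` of `J`, where `n = dim g`. -/
noncomputable def sigmaCoeff {g : Type*} [NormedAddCommGroup g] [InnerProductSpace ℝ g]
    [FiniteDimensional ℝ g] (k : ℕ) (J : g →ₗ[ℝ] g) : ℝ :=
  (-1 : ℝ) ^ k * (LinearMap.charpoly J).coeff (Module.finrank ℝ g - k)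

namespace LieStructure

open Filter Topology

section Euler

variable {g : Type*} [NormedAddCommGroup g] [InnerProductSpace ℝ g] [FiniteDimensional ℝ g]
variable (L : LieStructure g)

omit [FiniteDimensional ℝ g] in
theorem bracket_swap (x y : g) : L.bracket x y = -L.bracket y x := by
  have h := L.bracket_self (x + y)
  simp only [map_add, LinearMap.add_apply, L.bracket_self, zero_add, add_zero] at h
  exact eq_neg_of_add_eq_zero_right h

theorem inner_adT (x y z : g) : ⟪L.adT x y, z⟫_ℝ = ⟪y, L.bracket x z⟫_ℝ := by
  rw [adT, LinearMap.adjoint_inner_left]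
  rfl

theorem adT_add_left (x x' y : g) : L.adT (x + x') y = L.adT x y + L.adT x' y := by
  refine ext_inner_right ℝ fun z => ?_
  simp [inner_add_left, inner_adT, inner_add_right]

theorem adT_smul_left (r : ℝ) (x y : g) : L.adT (r • x) y = r • L.adT x y := by
  refine ext_inner_right ℝ fun z => ?_
  simp [inner_smul_left, inner_adT, inner_smul_right]

theorem adT_neg_neg (x : g) : L.adT (-x) (-x) = L.adT x x := by
  refine ext_inner_right ℝ fun z => ?_
  simp [inner_adT]

/-- A hyperbolic-secant orbit through `Z` that connects `-X` to `X`. -/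
theorem isSolution_tanh {X Z : g} {ω : ℝ} (hX : L.adT X X = 0) (hZ : L.adT Z Z = ω • X)
    (hXZ : L.adT X Z + L.adT Z X = -(ω • Z)) (s : ℝ) :
    L.IsSolution fun t => (Real.sinh (ω * (t + s)) / Real.cosh (ω * (t + s))) • X +
      (1 / Real.cosh (ω * (t + s))) • Z := by
  intro t
  have hc := (Real.cosh_pos (ω * (t + s))).ne'
  have hl : HasDerivAt (fun t : ℝ => ω * (t + s)) ω t := by
    simpa using ((hasDerivAt_id t).add_const s).const_mul ω
  have hs := hl.sinh
  have hch := hl.cosh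
  have hcs := Real.cosh_sq (ω * (t + s))
  set C := Real.cosh (ω * (t + s))
  set S := Real.sinh (ω * (t + s))
  have h1 := (hs.fun_div hch hc).smul_const X
  have h2 := ((hasDerivAt_const t (1 : ℝ)).fun_div hch hc).smul_const Z
  refine (h1.add h2).congr_deriv ?_
  change ((C * ω * C - S * (S * ω)) / C ^ 2) • X + ((0 * C - 1 * (S * ω)) / C ^ 2) • Z =
    L.adT ((S / C) • X + (1 / C) • Z) ((S / C) • X + (1 / C) • Z)
  have key : L.adT ((S / C) • X + (1 / C) • Z) ((S / C) • X + (1 / C) • Z) =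
      (1 / C * (1 / C) * ω) • X + (S / C * (1 / C) * (-ω)) • Z := by
    have e : L.adT X Z = -(ω • Z) - L.adT Z X := eq_sub_of_add_eq hXZ
    simp only [adT_add_left, adT_smul_left, map_add, map_smul, hX, hZ, e]
    module
  rw [key]
  congr 2
  · field_simp
    linear_combination ω * hcs
  · field_simp
    simp

theorem not_isStable_of_tanh_of_pos {X Z : g} {ω : ℝ} (hω : 0 < ω) (hX0 : X ≠ 0)
    (hX : L.adT X X = 0) (hZ : L.adT Z Z = ω • X)
    (hXZ : L.adT X Z + L.adT Z X = -(ω • Z)) : ¬ L.IsStable (-X) := by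
  intro hst
  have hne : Z + X ≠ 0 := by
    intro h
    rw [eq_neg_of_add_eq_zero_left h, adT_neg_neg, hX] at hZ
    exact smul_ne_zero hω.ne' hX0 hZ.symm
  obtain ⟨δ, hδ, H⟩ := hst ‖Z + X‖ (norm_pos_iff.2 hne)
  have hlim : Tendsto (fun T : ℝ => ‖(Real.exp (-T) / Real.cosh T) • X +
      (1 / Real.cosh T) • Z‖) atTop (𝓝 0) := by
    have hcosh : Tendsto Real.cosh atTop atTop := by
      refine tendsto_atTop_mono (fun x => ?_)
        (Real.tendsto_exp_atTop.atTop_div_const (two_pos : (0 : ℝ) < 2))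
      rw [Real.cosh_eq]
      linarith [Real.exp_pos (-x)]
    have h1 : Tendsto (fun T : ℝ => Real.exp (-T) / Real.cosh T) atTop (𝓝 0) :=
      (Real.tendsto_exp_neg_atTop_nhds_zero).div_atTop hcosh
    have h2 : Tendsto (fun T : ℝ => 1 / Real.cosh T) atTop (𝓝 0) :=
      tendsto_const_nhds.div_atTop hcosh
    simpa using ((h1.smul_const X).add (h2.smul_const Z)).norm
  obtain ⟨T, hT, hT0⟩ := ((hlim.eventually (gt_mem_nhds hδ)).and (eventually_ge_atTop 0)).exists
  have hsol := L.isSolution_tanh hX hZ hXZ (-(T / ω))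
  have := H _ hsol ?_ (T / ω) (by positivity)
  · simp at this
  · refine lt_of_eq_of_lt ?_ hT
    have e : ω * (0 + -(T / ω)) = -T := by field_simp; ring
    have hc := (Real.cosh_pos T).ne'
    simp only [e, Real.sinh_neg, Real.cosh_neg]
    congr 1
    have : Real.exp (-T) / Real.cosh T = 1 + -Real.sinh T / Real.cosh T := by
      rw [← Real.cosh_sub_sinh]
      field_simp
      ring
    rw [this]
    module

theorem exists_unstable_of_tanh {X Z : g} {ω : ℝ} (hω : ω ≠ 0) (hX0 : X ≠ 0)
    (hX : L.adT X X = 0) (hZ : L.adT Z Z = ω • X)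
    (hXZ : L.adT X Z + L.adT Z X = -(ω • Z)) : ∃ X : g, L.IsStationary X ∧ ¬ L.IsStable X := by
  have hX' : L.adT (-X) (-X) = 0 := by rw [adT_neg_neg, hX]
  rcases lt_or_gt_of_ne hω with h | h
  · have := L.not_isStable_of_tanh_of_pos (X := -X) (Z := Z) (neg_pos.2 h) (neg_ne_zero.2 hX0) hX'
      (by rw [hZ]; module)
      (by rw [← neg_one_smul ℝ X, adT_smul_left, map_smul, ← smul_add, hXZ]; module)
    exact ⟨X, hX, by simpa using this⟩
  · exact ⟨-X, hX', L.not_isStable_of_tanh_of_pos h hX0 hX hZ hXZ⟩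

theorem exists_unstable_of_rotation {X P Q : g} {ω : ℝ} (hω : 0 < ω) (hP0 : P ≠ 0)
    (hX : L.adT X X = 0) (hP : L.adT P P = 0) (hQ : L.adT Q Q = 0)
    (hPQ : L.adT P Q + L.adT Q P = 0) (hXP : L.adT X P + L.adT P X = Q)
    (hXQ : L.adT X Q + L.adT Q X = -(ω ^ 2 • P)) :
    ∃ X : g, L.IsStationary X ∧ ¬ L.IsStable X := by
  refine ⟨P, hP, fun hst => ?_⟩
  have hsol : ∀ ε : ℝ, L.IsSolution fun t => ε • X + (Real.cos (ε * ω * t) • P +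
      (ω⁻¹ * Real.sin (ε * ω * t)) • Q) := by
    intro ε t
    have hl : HasDerivAt (fun t : ℝ => ε * ω * t) (ε * ω) t := by
      simpa using (hasDerivAt_id t).const_mul (ε * ω)
    have h1 := hl.cos.smul_const P
    have h2 := (hl.sin.const_mul ω⁻¹).smul_const Q
    refine ((h1.add h2).const_add (ε • X)).congr_deriv ?_
    have e1 : L.adT X P = Q - L.adT P X := eq_sub_of_add_eq hXP
    have e2 : L.adT X Q = -(ω ^ 2 • P) - L.adT Q X := eq_sub_of_add_eq hXQ
    have e3 : L.adT P Q = - L.adT Q P := eq_neg_of_add_eq_zero_left hPQ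
    simp only [adT_add_left, adT_smul_left, map_add, map_smul, hX, hP, hQ, e1, e2, e3]
    match_scalars <;> field_simp <;> ring
  obtain ⟨δ, hδ, H⟩ := hst ‖P‖ (norm_pos_iff.2 hP0)
  have hm : 0 < min δ ‖P‖ := lt_min hδ (norm_pos_iff.2 hP0)
  obtain ⟨ε, hε, hεm⟩ : ∃ ε > 0, ε * ‖X‖ < min δ ‖P‖ := by
    refine ⟨min δ ‖P‖ / (‖X‖ + 1), by positivity, ?_⟩
    rw [div_mul_eq_mul_div, div_lt_iff₀ (by positivity)]
    nlinarith [norm_nonneg X]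
  have hnear : ‖ε • X + (Real.cos (ε * ω * 0) • P + (ω⁻¹ * Real.sin (ε * ω * 0)) • Q) - P‖ < δ := by
    simpa [norm_smul, abs_of_pos hε] using hεm.trans_le (min_le_left _ _)
  have hfar := H _ (hsol ε) hnear (Real.pi / (ε * ω)) (by positivity)
  have e : ε * ω * (Real.pi / (ε * ω)) = Real.pi := by field_simp
  simp only [e, Real.cos_pi, Real.sin_pi] at hfar
  have h2 : ‖(2 : ℝ) • P‖ ≤ ‖ε • X + (-1 : ℝ) • P + (ω⁻¹ * 0) • Q - P‖ + ‖ε • X‖ := by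
    refine le_trans (le_of_eq ?_) (norm_sub_le _ _)
    rw [← norm_neg]
    congr 1
    module
  rw [norm_smul, norm_smul, Real.norm_two, Real.norm_of_nonneg hε.le] at h2
  rw [← add_assoc] at hfar
  linarith [min_le_right δ ‖P‖]

end Euler

end LieStructure

open Module Polynomial in
theorem Polynomial.Monic.exists_isRoot_of_odd_natDegree_real {p : ℝ[X]} (hp : p.Monic)
    (hodd : Odd p.natDegree) : ∃ x, p.IsRoot x := by
  have hdeg : 0 < p.degree := natDegree_pos_iff_degree_pos.1 hodd.pos
  have htop := p.tendsto_atTop_of_leadingCoeff_nonneg hdeg (by simp [hp.leadingCoeff])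
  have hbot := (p.comp (-X)).tendsto_atBot_of_leadingCoeff_nonpos
    (natDegree_pos_iff_degree_pos.1 (by simpa [natDegree_comp] using hodd.pos))
    (by
      rw [leadingCoeff_comp (by simp)]
      simp [hp.leadingCoeff, hodd.neg_one_pow])
  obtain ⟨a, ha⟩ := (htop.eventually_ge_atTop 0).exists
  obtain ⟨b, hb⟩ := (hbot.eventually_le_atBot 0).exists
  obtain ⟨x, hx⟩ := mem_range_of_exists_le_of_exists_ge p.continuous
    ⟨-b, by simpa using hb⟩ ⟨a, ha⟩
  exact ⟨x, hx⟩

open Module in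
theorem LinearMap.exists_hasEigenvalue_of_odd_finrank {V : Type*} [AddCommGroup V] [Module ℝ V]
    [FiniteDimensional ℝ V] (f : V →ₗ[ℝ] V) (h : Odd (finrank ℝ V)) :
    ∃ μ, Module.End.HasEigenvalue f μ := by
  obtain ⟨μ, hμ⟩ := f.charpoly_monic.exists_isRoot_of_odd_natDegree_real
    (by rwa [f.charpoly_natDegree])
  exact ⟨μ, Module.End.hasEigenvalue_iff_isRoot_charpoly _ _ |>.2 hμ⟩

/-- Fewer linear functionals than the dimension have a common nonzero zero. -/
theorem exists_ne_zero_forall_inner_eq_zero {g : Type*} [NormedAddCommGroup g]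
    [InnerProductSpace ℝ g] [FiniteDimensional ℝ g] {k : ℕ} (hk : k < Module.finrank ℝ g)
    (w : Fin k → g) : ∃ v : g, v ≠ 0 ∧ ∀ i, ⟪w i, v⟫_ℝ = 0 := by
  let f : g →ₗ[ℝ] (Fin k → ℝ) := LinearMap.pi fun i => (innerSL ℝ (w i)).toLinearMap
  have hf : LinearMap.ker f ≠ ⊥ := f.ker_ne_bot_of_finrank_lt (by simpa using hk)
  obtain ⟨v, hv, hv0⟩ := (Submodule.ne_bot_iff _).1 hf
  refine ⟨v, hv0, fun i => ?_⟩
  have := congrFun (LinearMap.mem_ker.1 hv) i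
  simpa [f] using this

theorem eq_zero_or_eq_zero_of_forall_inner_mul_inner_eq_zero {g : Type*} [NormedAddCommGroup g]
    [InnerProductSpace ℝ g] {u v : g} (h : ∀ x, ⟪x, u⟫_ℝ * ⟪x, v⟫_ℝ = 0) : u = 0 ∨ v = 0 := by
  by_contra! hne
  have hu := h u
  have hv := h v
  have huv := h (u + v)
  have h1 : ⟪u, u⟫_ℝ ≠ 0 := inner_self_ne_zero.2 hne.1
  have h2 : ⟪v, v⟫_ℝ ≠ 0 := inner_self_ne_zero.2 hne.2
  have h3 : ⟪u, v⟫_ℝ = 0 := (mul_eq_zero.1 hu).resolve_left h1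
  rw [inner_add_left, inner_add_left, h3, real_inner_comm u v, h3, add_zero, zero_add] at huv
  exact mul_ne_zero h1 h2 huv

/-- A `2 × 2` matrix of vectors whose determinant vanishes in the symmetric square has dependent
rows or dependent columns. -/
theorem rows_or_columns_dependent {g : Type*} [NormedAddCommGroup g]
    [InnerProductSpace ℝ g] {p q r s : g}
    (h : ∀ x, ⟪x, p⟫_ℝ * ⟪x, s⟫_ℝ = ⟪x, q⟫_ℝ * ⟪x, r⟫_ℝ) :
    (∃ a b : ℝ, (a ≠ 0 ∨ b ≠ 0) ∧ a • p + b • q = 0 ∧ a • r + b • s = 0) ∨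
    (∃ a b : ℝ, (a ≠ 0 ∨ b ≠ 0) ∧ a • p + b • r = 0 ∧ a • q + b • s = 0) := by
  by_cases hp : p = 0
  · subst hp
    have : q = 0 ∨ r = 0 := eq_zero_or_eq_zero_of_forall_inner_mul_inner_eq_zero fun x => by
      rw [← h x]; simp
    rcases this with rfl | rfl
    · exact Or.inr ⟨1, 0, by simp⟩
    · exact Or.inl ⟨1, 0, by simp⟩
  have hpp : ⟪p, p⟫_ℝ ≠ 0 := inner_self_ne_zero.2 hp
  have proj : ∀ x : g, ∀ y : g, ⟪x - (⟪x, p⟫_ℝ / ⟪p, p⟫_ℝ) • p, y⟫_ℝ =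
      ⟪x, y - (⟪p, y⟫_ℝ / ⟪p, p⟫_ℝ) • p⟫_ℝ := fun x y => by
    simp only [inner_sub_left, inner_sub_right, inner_smul_left, inner_smul_right]
    simp
    ring
  have key : q - (⟪p, q⟫_ℝ / ⟪p, p⟫_ℝ) • p = 0 ∨ r - (⟪p, r⟫_ℝ / ⟪p, p⟫_ℝ) • p = 0 := by
    refine eq_zero_or_eq_zero_of_forall_inner_mul_inner_eq_zero fun x => ?_
    have hx := h (x - (⟪x, p⟫_ℝ / ⟪p, p⟫_ℝ) • p)
    rw [proj, proj x q, proj x r, div_self hpp, one_smul, sub_self, inner_zero_right,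
      zero_mul] at hx
    exact hx.symm
  rcases key with hq | hr
  · set c := ⟪p, q⟫_ℝ / ⟪p, p⟫_ℝ
    have hq' : q = c • p := sub_eq_zero.1 hq
    have hs : s - c • r = 0 := by
      refine (eq_zero_or_eq_zero_of_forall_inner_mul_inner_eq_zero fun x => ?_).resolve_left hp
      have := h x
      rw [hq', inner_smul_right] at this
      rw [inner_sub_right, inner_smul_right]
      linear_combination this
    refine Or.inl ⟨-c, 1, by simp, ?_, ?_⟩
    · rw [hq']; module
    · rw [sub_eq_zero.1 hs]; module
  · set c := ⟪p, r⟫_ℝ / ⟪p, p⟫_ℝ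
    have hr' : r = c • p := sub_eq_zero.1 hr
    have hs : s - c • q = 0 := by
      refine (eq_zero_or_eq_zero_of_forall_inner_mul_inner_eq_zero fun x => ?_).resolve_left hp
      have := h x
      rw [hr', inner_smul_right] at this
      rw [inner_sub_right, inner_smul_right]
      linear_combination this
    refine Or.inr ⟨-c, 1, by simp, ?_, ?_⟩
    · rw [hr']; module
    · rw [sub_eq_zero.1 hs]; module

namespace LieStructure

variable {g : Type*} [NormedAddCommGroup g] [InnerProductSpace ℝ g] [FiniteDimensional ℝ g]
variable (L : LieStructure g)

/-- In a nonzero unimodular Lie algebra no form `(y, z) ↦ ⟪x, [y, z]⟫` is symplectic. -/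
theorem IsUnimodular.exists_ne_zero_inner_bracket_eq_zero {L : LieStructure g}
    (hL : L.IsUnimodular) (hdim : Module.finrank ℝ g ≠ 0) (x : g) :
    ∃ u : g, u ≠ 0 ∧ ∀ z, ⟪x, L.bracket u z⟫_ℝ = 0 := by
  let B : g →ₗ[ℝ] g :=
    { toFun := fun y => L.adT y x
      map_add' := fun y z => L.adT_add_left y z x
      map_smul' := fun r y => L.adT_smul_left r y x }
  have hB : ∀ y z, ⟪B y, z⟫_ℝ = ⟪x, L.bracket y z⟫_ℝ := fun y z => L.inner_adT y x z
  by_contra! hcon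
  have hinj : Function.Injective B := by
    refine (injective_iff_map_eq_zero B).2 fun u hu => ?_
    by_contra hu0
    obtain ⟨z, hz⟩ := hcon u hu0
    rw [← hB, hu, inner_zero_left] at hz
    exact hz rfl
  let e := LinearEquiv.ofInjectiveEndo B hinj
  have he : ∀ y, e y = B y := fun y => rfl
  obtain ⟨E, hE⟩ := e.surjective x
  have hE' : ∀ z, ⟪x, L.bracket E z⟫_ℝ = ⟪x, z⟫_ℝ := fun z => by rw [← hB, ← he, hE]
  have hrel : L.ad E + e.symm.conj (L.adT E) = LinearMap.id := by
    ext y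
    apply e.injective
    simp only [LinearMap.add_apply, map_add, LinearEquiv.conj_apply_apply, LinearEquiv.symm_symm,
      LinearEquiv.apply_symm_apply, LinearMap.id_apply]
    rw [he, he]
    refine ext_inner_right ℝ fun z => ?_
    rw [inner_add_left, inner_adT, hB, hB, hB, ← hE' (L.bracket y z), ← inner_add_right]
    congr 1
    have := L.jacobi E y z
    have h1 := L.bracket_swap z E
    have h2 := L.bracket_swap z (L.bracket E y)
    rw [h1, h2, map_neg] at this
    change L.bracket (L.bracket E y) z + _ = _
    linear_combination (norm := module) -this
  have htr := congrArg (LinearMap.trace ℝ g) hrel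
  have hT : LinearMap.trace ℝ g (L.adT E) = 0 := by
    have b := stdOrthonormalBasis ℝ g
    rw [← hL E, LinearMap.trace_eq_sum_inner _ b, LinearMap.trace_eq_sum_inner _ b]
    refine Finset.sum_congr rfl fun i _ => ?_
    rw [real_inner_comm, inner_adT]
    rfl
  rw [map_add, hL E, LinearMap.trace_conj', hT, LinearMap.trace_id] at htr
  simp at htr
  exact hdim (by exact_mod_cast htr.symm)

end LieStructure

theorem exists_smul_add_eq_of_finrank_eq_four {g : Type*} [AddCommGroup g] [Module ℝ g]
    [FiniteDimensional ℝ g] (hdim : Module.finrank ℝ g = 4) {a b c d : g}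
    (h : ∀ s t p q : ℝ, s • a + t • b + p • c + q • d = 0 → s = 0 ∧ t = 0 ∧ p = 0 ∧ q = 0)
    (y : g) : ∃ s t p q : ℝ, y = s • a + t • b + p • c + q • d := by
  have hli : LinearIndependent ℝ ![a, b, c, d] := by
    rw [Fintype.linearIndependent_iff]
    intro k hk
    simp only [Fin.sum_univ_four] at hk
    obtain ⟨h0, h1, h2, h3⟩ := h _ _ _ _ hk
    intro i
    fin_cases i <;> assumption
  let B := basisOfLinearIndependentOfCardEqFinrank hli (by simp [hdim])
  have hB := B.sum_repr y
  simp only [Fin.sum_univ_four, B, coe_basisOfLinearIndependentOfCardEqFinrank] at hB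
  exact ⟨_, _, _, _, hB.symm⟩

theorem exists_orthonormalBasis_apply_three_eq {g : Type*} [NormedAddCommGroup g]
    [InnerProductSpace ℝ g] [FiniteDimensional ℝ g] (hdim : Module.finrank ℝ g = 4) {e : g}
    (he : ‖e‖ = 1) : ∃ b : OrthonormalBasis (Fin 4) ℝ g, b 3 = e := by
  have ho : Orthonormal ℝ (({3} : Set (Fin 4)).domRestrict fun _ => e) := by
    refine ⟨fun _ => he, fun i j hij => (hij (Subsingleton.elim _ _)).elim⟩
  obtain ⟨b, hb⟩ := ho.exists_orthonormalBasis_extension_of_card_eq (by simp [hdim])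
  exact ⟨b, hb 3 rfl⟩

namespace LieStructure

variable {g : Type*} [NormedAddCommGroup g] [InnerProductSpace ℝ g] [FiniteDimensional ℝ g]
variable {L : LieStructure g}

/-- A four-dimensional unimodular Lie algebra has nontrivial centre or an abelian hyperplane. -/
theorem IsUnimodular.exists_central_or_abelian_hyperplane (hL : L.IsUnimodular)
    (hdim : Module.finrank ℝ g = 4) :
    (∃ c : g, c ≠ 0 ∧ ∀ x, L.bracket c x = 0) ∨
    ∃ e : g, ‖e‖ = 1 ∧ ∀ y z, ⟪e, y⟫_ℝ = 0 → ⟪e, z⟫_ℝ = 0 → L.bracket y z = 0 := by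
  by_cases hab : ∀ y z, L.bracket y z = 0
  · have : Nontrivial g := Module.nontrivial_of_finrank_pos (R := ℝ) (by omega)
    obtain ⟨c, hc⟩ := exists_ne (0 : g)
    exact Or.inl ⟨c, hc, hab c⟩
  push Not at hab
  obtain ⟨a₀, b, hab₀⟩ := hab
  set x₀ := L.bracket a₀ b with hx₀
  obtain ⟨a, hω⟩ : ∃ a, ⟪x₀, L.bracket a b⟫_ℝ = 1 := by
    refine ⟨(⟪x₀, x₀⟫_ℝ)⁻¹ • a₀, ?_⟩
    rw [map_smul, LinearMap.smul_apply, inner_smul_right, ← hx₀]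
    exact inv_mul_cancel₀ (inner_self_ne_zero.2 hab₀)
  obtain ⟨u, hu0, hu⟩ := hL.exists_ne_zero_inner_bracket_eq_zero (by omega) x₀
  obtain ⟨v, hv0, hv⟩ := exists_ne_zero_forall_inner_eq_zero (k := 3) (by omega)
    ![u, L.adT a x₀, L.adT b x₀]
  have huv : ⟪u, v⟫_ℝ = 0 := hv 0
  have hav : ⟪x₀, L.bracket a v⟫_ℝ = 0 := by rw [← inner_adT]; exact hv 1
  have hbv : ⟪x₀, L.bracket b v⟫_ℝ = 0 := by rw [← inner_adT]; exact hv 2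
  have hau : ⟪x₀, L.bracket a u⟫_ℝ = 0 := by rw [bracket_swap, inner_neg_right, hu, neg_zero]
  have hbu : ⟪x₀, L.bracket b u⟫_ℝ = 0 := by rw [bracket_swap, inner_neg_right, hu, neg_zero]
  have hli : ∀ s t p q : ℝ, s • a + t • b + p • u + q • v = 0 →
      s = 0 ∧ t = 0 ∧ p = 0 ∧ q = 0 := by
    intro s t p q h
    have h1 : ⟪x₀, L.bracket a (s • a + t • b + p • u + q • v)⟫_ℝ = 0 := by simp [h]
    have h2 : ⟪x₀, L.bracket b (s • a + t • b + p • u + q • v)⟫_ℝ = 0 := by simp [h]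
    have hba : ⟪x₀, L.bracket b a⟫_ℝ = -1 := by rw [bracket_swap, inner_neg_right, hω]
    simp [inner_add_right, inner_smul_right, L.bracket_self, hω, hav, hau, hbu, hbv, hba] at h1 h2
    have h3 : ⟪u, s • a + t • b + p • u + q • v⟫_ℝ = 0 := by simp [h]
    simp [h1, h2, inner_add_right, inner_smul_right, huv, hu0] at h3
    subst h1 h2 h3
    simpa [hv0] using h
  have hspan := exists_smul_add_eq_of_finrank_eq_four hdim hli
  have hPf : ∀ x, ⟪x, L.bracket a b⟫_ℝ * ⟪x, L.bracket u v⟫_ℝ -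
      ⟪x, L.bracket a u⟫_ℝ * ⟪x, L.bracket b v⟫_ℝ +
      ⟪x, L.bracket a v⟫_ℝ * ⟪x, L.bracket b u⟫_ℝ = 0 := by
    intro x
    obtain ⟨w, hw0, hw⟩ := hL.exists_ne_zero_inner_bracket_eq_zero (by omega) x
    obtain ⟨s, t, p, q, rfl⟩ := hspan w
    have ha := hw a
    have hb := hw b
    have hu := hw u
    have hv := hw v
    simp only [map_add, map_smul, LinearMap.add_apply, LinearMap.smul_apply, inner_add_right,
      inner_smul_right, L.bracket_self, inner_zero_right, L.bracket_swap b a,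
      L.bracket_swap u a, L.bracket_swap u b, L.bracket_swap v a, L.bracket_swap v b,
      L.bracket_swap v u, inner_neg_right] at ha hb hu hv
    by_contra hne
    refine hw0 ?_
    have hs : s = 0 := by
      refine (mul_eq_zero.1 ?_).resolve_left hne
      linear_combination ⟪x, L.bracket u v⟫_ℝ * hb - ⟪x, L.bracket b v⟫_ℝ * hu +
        ⟪x, L.bracket b u⟫_ℝ * hv
    have ht : t = 0 := by
      refine (mul_eq_zero.1 ?_).resolve_left hne
      linear_combination -⟪x, L.bracket u v⟫_ℝ * ha + ⟪x, L.bracket a v⟫_ℝ * hu -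
        ⟪x, L.bracket a u⟫_ℝ * hv
    have hp : p = 0 := by
      refine (mul_eq_zero.1 ?_).resolve_left hne
      linear_combination ⟪x, L.bracket b v⟫_ℝ * ha - ⟪x, L.bracket a v⟫_ℝ * hb +
        ⟪x, L.bracket a b⟫_ℝ * hv
    have hq : q = 0 := by
      refine (mul_eq_zero.1 ?_).resolve_left hne
      linear_combination -⟪x, L.bracket b u⟫_ℝ * ha + ⟪x, L.bracket a u⟫_ℝ * hb -
        ⟪x, L.bracket a b⟫_ℝ * hu
    simp [hs, ht, hp, hq]
  have huv' : L.bracket u v = 0 := by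
    refine ext_inner_left ℝ fun x => ?_
    have h1 := hPf x
    have h2 := hPf (x₀ + x)
    simp only [inner_add_left, hω, hau, hav, hbu, hbv, hu] at h2
    rw [inner_zero_right]
    linear_combination h2 - h1
  have hvu' : L.bracket v u = 0 := by rw [bracket_swap, huv', neg_zero]
  have hdet : ∀ x, ⟪x, L.bracket a u⟫_ℝ * ⟪x, L.bracket b v⟫_ℝ =
      ⟪x, L.bracket a v⟫_ℝ * ⟪x, L.bracket b u⟫_ℝ := fun x => by
    have := hPf x
    rw [huv', inner_zero_right] at this
    linear_combination -this
  rcases rows_or_columns_dependent hdet with ⟨α, β, hαβ, h1, h2⟩ | ⟨α, β, hαβ, h1, h2⟩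
  · refine Or.inl ⟨α • u + β • v, fun h => ?_, fun x => ?_⟩
    · have := hli 0 0 α β (by simpa using h)
      tauto
    · obtain ⟨s, t, p, q, rfl⟩ := hspan x
      simp only [map_add, map_smul, LinearMap.add_apply, LinearMap.smul_apply, L.bracket_self,
        L.bracket_swap u a, L.bracket_swap u b, L.bracket_swap v a, L.bracket_swap v b,
        huv', hvu']
      linear_combination (norm := module) -s • h1 - t • h2
  · obtain ⟨e₀, he0, he⟩ := exists_ne_zero_forall_inner_eq_zero (k := 3) (by omega)
      ![α • a + β • b, u, v]
    have hf : ⟪e₀, α • a + β • b⟫_ℝ = 0 := by rw [real_inner_comm]; exact he 0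
    have hu : ⟪e₀, u⟫_ℝ = 0 := by rw [real_inner_comm]; exact he 1
    have hv : ⟪e₀, v⟫_ℝ = 0 := by rw [real_inner_comm]; exact he 2
    have hspan' := exists_smul_add_eq_of_finrank_eq_four hdim
      (a := α • a + β • b) (b := u) (c := v) (d := e₀) (by
        intro s t p q h
        have hq : ⟪e₀, s • (α • a + β • b) + t • u + p • v + q • e₀⟫_ℝ = 0 := by
          rw [h, inner_zero_right]
        rw [inner_add_right, inner_add_right, inner_add_right, inner_smul_right, inner_smul_right,
          inner_smul_right, inner_smul_right, hf, hu, hv] at hq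
        simp [he0] at hq
        have := hli (s * α) (s * β) t p (by rw [← h, hq]; module)
        simp only [mul_eq_zero] at this
        tauto)
    refine Or.inr ⟨‖e₀‖⁻¹ • e₀, norm_smul_inv_norm he0, fun y z hy hz => ?_⟩
    have hperp : ∀ y, ⟪‖e₀‖⁻¹ • e₀, y⟫_ℝ = 0 →
        ∃ s t p : ℝ, y = s • (α • a + β • b) + t • u + p • v := by
      intro y hy
      obtain ⟨s, t, p, q, rfl⟩ := hspan' y
      rw [inner_smul_left, inner_add_right, inner_add_right, inner_add_right, inner_smul_right,
        inner_smul_right, inner_smul_right, inner_smul_right, hf, hu, hv] at hy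
      simp [he0] at hy
      exact ⟨s, t, p, by simp [hy]⟩
    obtain ⟨s, t, p, rfl⟩ := hperp y hy
    obtain ⟨s', t', p', rfl⟩ := hperp z hz
    have hfu : L.bracket (α • a + β • b) u = 0 := by simpa using h1
    have hfv : L.bracket (α • a + β • b) v = 0 := by simpa using h2
    have huf : L.bracket u (α • a + β • b) = 0 := by rw [bracket_swap, hfu, neg_zero]
    have hvf : L.bracket v (α • a + β • b) = 0 := by rw [bracket_swap, hfv, neg_zero]
    generalize α • a + β • b = f at *
    simp [L.bracket_self, hfu, hfv, huf, hvf, huv', hvu']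

open Module in
theorem exists_unstable_of_abelian_hyperplane (hL : L.IsUnimodular)
    (hdim : Module.finrank ℝ g = 4) (hcen : ∀ c : g, c ≠ 0 → ∃ x, L.bracket c x ≠ 0) {e : g}
    (he : ‖e‖ = 1) (hcomm : ∀ y z, ⟪e, y⟫_ℝ = 0 → ⟪e, z⟫_ℝ = 0 → L.bracket y z = 0) :
    ∃ X : g, L.IsStationary X ∧ ¬ L.IsStable X := by
  have hee : ⟪e, e⟫_ℝ = 1 := by rw [real_inner_self_eq_norm_sq, he, one_pow]
  have he0 : e ≠ 0 := by
    rintro rfl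
    simp at he
  have hdec : ∀ z, ∃ y, ⟪e, y⟫_ℝ = 0 ∧ z = ⟪e, z⟫_ℝ • e + y := fun z =>
    ⟨z - ⟪e, z⟫_ℝ • e, by simp [inner_sub_right, inner_smul_right, he], by module⟩
  have hideal : ∀ z, ⟪e, z⟫_ℝ = 0 → ⟪e, L.bracket z e⟫_ℝ = 0 := by
    intro z hz
    obtain ⟨b, hb⟩ := exists_orthonormalBasis_apply_three_eq hdim he
    have htr := hL z
    have hbi : ∀ i, i ≠ 3 → L.bracket z (b i) = 0 := fun i hi =>
      hcomm _ _ hz (by rw [← hb]; exact b.orthonormal.2 hi.symm)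
    rw [LinearMap.trace_eq_sum_inner _ b, Fin.sum_univ_four] at htr
    change ⟪b 0, L.bracket z (b 0)⟫_ℝ + ⟪b 1, L.bracket z (b 1)⟫_ℝ +
      ⟪b 2, L.bracket z (b 2)⟫_ℝ + ⟪b 3, L.bracket z (b 3)⟫_ℝ = 0 at htr
    rw [hbi 0 (by decide), hbi 1 (by decide), hbi 2 (by decide), hb] at htr
    simpa using htr
  have hrange : ∀ z, ⟪e, L.bracket e z⟫_ℝ = 0 := by
    intro z
    obtain ⟨y, hy, hz⟩ := hdec z
    rw [hz, map_add, map_smul, L.bracket_self, smul_zero, zero_add, L.bracket_swap,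
      inner_neg_right, hideal y hy, neg_zero]
  let V : Submodule ℝ g := (ℝ ∙ e)ᗮ
  have hV : ∀ y, y ∈ V ↔ ⟪e, y⟫_ℝ = 0 := fun y => Submodule.mem_orthogonal_singleton_iff_inner_right
  have hVdim : finrank ℝ V = 3 := by
    have : Fact (finrank ℝ g = 3 + 1) := ⟨hdim⟩
    exact Submodule.finrank_orthogonal_span_singleton he0
  have hadT : ∀ y ∈ V, L.adT e y ∈ V := fun y _ => by
    rw [hV, real_inner_comm, inner_adT, L.bracket_self, inner_zero_right]
  have had : ∀ y ∈ V, L.ad e y ∈ V := fun y _ => (hV _).2 (hrange y)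
  obtain ⟨μ, hμ⟩ := ((L.adT e).restrict hadT).exists_hasEigenvalue_of_odd_finrank
    (by rw [hVdim]; decide)
  obtain ⟨⟨v₀, hv₀V⟩, hv₀⟩ := hμ.exists_hasEigenvector
  have hv₀0 : v₀ ≠ 0 := fun h => hv₀.2 (Subtype.ext h)
  have hv₀μ : L.adT e v₀ = μ • v₀ := congrArg Subtype.val hv₀.apply_eq_smul
  have hμ0 : μ ≠ 0 := by
    rintro rfl
    have hinj : Function.Injective ((L.ad e).restrict had) := by
      refine (injective_iff_map_eq_zero _).2 fun ⟨w, hw⟩ hw' => ?_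
      have hew : L.bracket e w = 0 := congrArg Subtype.val hw'
      rw [Submodule.mk_eq_zero]
      by_contra hw0
      obtain ⟨x, hx⟩ := hcen w hw0
      obtain ⟨y, hy, hxy⟩ := hdec x
      refine hx ?_
      rw [hxy, map_add, map_smul, hcomm w y ((hV w).1 hw) hy, L.bracket_swap, hew]
      simp
    obtain ⟨⟨w, _⟩, hw'⟩ := LinearMap.injective_iff_surjective.1 hinj ⟨v₀, hv₀V⟩
    have hew : L.bracket e w = v₀ := congrArg Subtype.val hw'
    have : ⟪v₀, L.bracket e w⟫_ℝ = 0 := by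
      rw [← inner_adT, hv₀μ, zero_smul, inner_zero_left]
    rw [hew] at this
    exact hv₀0 (inner_self_eq_zero.1 this)
  obtain ⟨v, hv1, hev, hvμ⟩ : ∃ v : g, ‖v‖ = 1 ∧ ⟪e, v⟫_ℝ = 0 ∧ L.adT e v = μ • v :=
    ⟨‖v₀‖⁻¹ • v₀, norm_smul_inv_norm hv₀0,
      by rw [inner_smul_right, (hV v₀).1 hv₀V, mul_zero],
      by rw [map_smul, hv₀μ, smul_comm]⟩
  have hvv : ⟪v, v⟫_ℝ = 1 := by rw [real_inner_self_eq_norm_sq, hv1, one_pow]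
  refine L.exists_unstable_of_tanh (X := e) (Z := v) (neg_ne_zero.2 hμ0) he0 ?_ ?_ ?_
  · refine ext_inner_right ℝ fun z => ?_
    rw [inner_adT, hrange, inner_zero_left]
  · refine ext_inner_right ℝ fun z => ?_
    obtain ⟨y, hy, hz⟩ := hdec z
    have h1 : ⟪v, L.bracket e v⟫_ℝ = μ := by
      rw [← inner_adT, hvμ, inner_smul_left, hvv]
      simp
    rw [inner_adT, inner_smul_left]
    nth_rw 1 [hz]
    rw [map_add, map_smul, hcomm v y hev hy, add_zero, L.bracket_swap, inner_smul_right,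
      inner_neg_right, h1]
    simp
    ring
  · have : L.adT v e = 0 := by
      refine ext_inner_right ℝ fun z => ?_
      obtain ⟨y, hy, hz⟩ := hdec z
      rw [inner_adT, hz, map_add, map_smul, hcomm v y hev hy, add_zero, inner_smul_right,
        hideal v hev]
      simp
    rw [this, hvμ]
    module

end LieStructure

namespace LieStructure

variable {g : Type*} [NormedAddCommGroup g] [InnerProductSpace ℝ g] [FiniteDimensional ℝ g]
variable {L : LieStructure g}

/-- An orthonormal frame `p, q, r, c` with `c` central in which the bracket on `p, q, r` is the
central extension of a diagonal (Milnor) frame. -/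
structure IsMilnorFrame (L : LieStructure g) (p q r c : g) (n₀ n₁ n₂ β₀ β₁ β₂ : ℝ) : Prop where
  orthonormal : Orthonormal ℝ ![p, q, r, c]
  exists_eq : ∀ z, ∃ z₀ z₁ z₂ k : ℝ, z = z₀ • p + z₁ • q + z₂ • r + k • c
  bracket_q_r : L.bracket q r = n₀ • p + β₀ • c
  bracket_r_p : L.bracket r p = n₁ • q + β₁ • c
  bracket_p_q : L.bracket p q = n₂ • r + β₂ • c
  central : ∀ x, L.bracket c x = 0

namespace IsMilnorFrame

variable {p q r c : g} {n₀ n₁ n₂ β₀ β₁ β₂ : ℝ}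

omit [FiniteDimensional ℝ g] in
theorem rotate (F : L.IsMilnorFrame p q r c n₀ n₁ n₂ β₀ β₁ β₂) :
    L.IsMilnorFrame q r p c n₁ n₂ n₀ β₁ β₂ β₀ where
  orthonormal := by
    convert F.orthonormal.comp ![1, 2, 0, 3] (by decide) using 1
    ext i
    fin_cases i <;> rfl
  exists_eq z := by
    obtain ⟨z₀, z₁, z₂, k, h⟩ := F.exists_eq z
    exact ⟨z₁, z₂, z₀, k, by rw [h]; module⟩
  bracket_q_r := F.bracket_r_p
  bracket_r_p := F.bracket_p_q
  bracket_p_q := F.bracket_q_r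
  central := F.central

omit [FiniteDimensional ℝ g] in
theorem inner_comb (F : L.IsMilnorFrame p q r c n₀ n₁ n₂ β₀ β₁ β₂)
    (y₀ y₁ y₂ k z₀ z₁ z₂ l : ℝ) :
    ⟪y₀ • p + y₁ • q + y₂ • r + k • c, z₀ • p + z₁ • q + z₂ • r + l • c⟫_ℝ =
      y₀ * z₀ + y₁ * z₁ + y₂ * z₂ + k * l := by
  have := F.orthonormal.inner_sum ![y₀, y₁, y₂, k] ![z₀, z₁, z₂, l] Finset.univ
  simpa [Fin.sum_univ_four] using this

omit [FiniteDimensional ℝ g] in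
theorem bracket_comb (F : L.IsMilnorFrame p q r c n₀ n₁ n₂ β₀ β₁ β₂)
    (y₀ y₁ y₂ k z₀ z₁ z₂ l : ℝ) :
    L.bracket (y₀ • p + y₁ • q + y₂ • r + k • c) (z₀ • p + z₁ • q + z₂ • r + l • c) =
      ((y₁ * z₂ - y₂ * z₁) * n₀) • p + ((y₂ * z₀ - y₀ * z₂) * n₁) • q +
      ((y₀ * z₁ - y₁ * z₀) * n₂) • r + ((y₁ * z₂ - y₂ * z₁) * β₀ + (y₂ * z₀ - y₀ * z₂) * β₁ +
        (y₀ * z₁ - y₁ * z₀) * β₂) • c := by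
  have hc : ∀ x, L.bracket x c = 0 := fun x => by rw [bracket_swap, F.central, neg_zero]
  simp only [map_add, map_smul, LinearMap.add_apply, LinearMap.smul_apply, L.bracket_self,
    F.central, hc, L.bracket_swap r q, L.bracket_swap q p, L.bracket_swap p r, F.bracket_q_r,
    F.bracket_r_p, F.bracket_p_q]
  module

theorem adT_comb (F : L.IsMilnorFrame p q r c n₀ n₁ n₂ β₀ β₁ β₂)
    (y₀ y₁ y₂ k z₀ z₁ z₂ l : ℝ) :
    L.adT (y₀ • p + y₁ • q + y₂ • r + k • c) (z₀ • p + z₁ • q + z₂ • r + l • c) =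
      (y₂ * (n₁ * z₁ + β₁ * l) - y₁ * (n₂ * z₂ + β₂ * l)) • p +
      (y₀ * (n₂ * z₂ + β₂ * l) - y₂ * (n₀ * z₀ + β₀ * l)) • q +
      (y₁ * (n₀ * z₀ + β₀ * l) - y₀ * (n₁ * z₁ + β₁ * l)) • r + (0 : ℝ) • c := by
  refine ext_inner_right ℝ fun x => ?_
  obtain ⟨x₀, x₁, x₂, m, rfl⟩ := F.exists_eq x
  rw [inner_adT, F.bracket_comb, F.inner_comb, F.inner_comb]
  ring

omit [FiniteDimensional ℝ g] in
theorem comb_ne_zero (F : L.IsMilnorFrame p q r c n₀ n₁ n₂ β₀ β₁ β₂) {y₀ y₁ y₂ k : ℝ}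
    (h : y₀ ^ 2 + y₁ ^ 2 + y₂ ^ 2 + k ^ 2 ≠ 0) : y₀ • p + y₁ • q + y₂ • r + k • c ≠ 0 := by
  intro h0
  have := F.inner_comb y₀ y₁ y₂ k y₀ y₁ y₂ k
  rw [h0, inner_zero_left] at this
  exact h (by rw [this]; ring)

/-- The intermediate axis of an asymmetric rigid body is unstable. -/
theorem exists_unstable_of_intermediate (F : L.IsMilnorFrame p q r c n₀ n₁ n₂ β₀ β₁ β₂)
    (h : 0 < (n₁ - n₂) * (n₀ - n₁)) : ∃ X : g, L.IsStationary X ∧ ¬ L.IsStable X := by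
  have hne : n₂ - n₀ ≠ 0 := by
    intro h0
    have : n₀ = n₂ := by linarith
    subst this
    nlinarith [sq_nonneg (n₁ - n₀)]
  have hn₀ : n₁ - n₂ ≠ 0 := left_ne_zero_of_mul h.ne'
  have hn₂ : n₀ - n₁ ≠ 0 := right_ne_zero_of_mul h.ne'
  have hpos₀ : 0 < -(n₁ - n₂) / (n₂ - n₀) := by
    have e : -(n₁ - n₂) / (n₂ - n₀) =
        ((n₁ - n₂) ^ 2 + (n₁ - n₂) * (n₀ - n₁)) / (n₂ - n₀) ^ 2 := by
      field_simp
      ring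
    rw [e]
    positivity
  have hpos₂ : 0 < -(n₀ - n₁) / (n₂ - n₀) := by
    have e : -(n₀ - n₁) / (n₂ - n₀) =
        ((n₀ - n₁) ^ 2 + (n₁ - n₂) * (n₀ - n₁)) / (n₂ - n₀) ^ 2 := by
      field_simp
      ring
    rw [e]
    positivity
  obtain ⟨α, hα0, hα⟩ : ∃ α : ℝ, 0 < α ∧ (n₂ - n₀) * α ^ 2 = -(n₁ - n₂) :=
    ⟨_, Real.sqrt_pos.2 hpos₀, by rw [Real.sq_sqrt hpos₀.le]; field_simp⟩
  obtain ⟨β, hβ0, hβ⟩ : ∃ β : ℝ, 0 < β ∧ (n₂ - n₀) * β ^ 2 = -(n₀ - n₁) :=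
    ⟨_, Real.sqrt_pos.2 hpos₂, by rw [Real.sq_sqrt hpos₂.le]; field_simp⟩
  refine L.exists_unstable_of_tanh
    (X := (0 : ℝ) • p + (1 : ℝ) • q + (0 : ℝ) • r + (0 : ℝ) • c)
    (Z := α • p + (0 : ℝ) • q + β • r + (0 : ℝ) • c) (ω := (n₂ - n₀) * α * β)
    (mul_ne_zero (mul_ne_zero hne hα0.ne') hβ0.ne') (F.comb_ne_zero (by norm_num)) ?_ ?_ ?_
  · rw [F.adT_comb]
    module
  · rw [F.adT_comb]
    module
  · rw [F.adT_comb, F.adT_comb]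
    match_scalars
    · linear_combination β * hα
    · ring
    · linear_combination α * hβ
    · ring

theorem exists_unstable_of_symmetric (F : L.IsMilnorFrame p q r c n₀ n₁ n₂ β₀ β₁ β₂)
    (h : n₀ = n₁) (h' : n₁ ≠ n₂) : ∃ X : g, L.IsStationary X ∧ ¬ L.IsStable X := by
  subst h
  refine L.exists_unstable_of_rotation
    (X := (0 : ℝ) • p + (0 : ℝ) • q + (1 : ℝ) • r + (0 : ℝ) • c)
    (P := (1 : ℝ) • p + (0 : ℝ) • q + (0 : ℝ) • r + (0 : ℝ) • c)
    (Q := (0 : ℝ) • p + (-(n₀ - n₂)) • q + (0 : ℝ) • r + (0 : ℝ) • c)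
    (ω := |n₀ - n₂|) (abs_pos.2 (sub_ne_zero.2 h')) (F.comb_ne_zero (by norm_num))
    ?_ ?_ ?_ ?_ ?_ ?_ <;> rw [F.adT_comb]
  · module
  · module
  · module
  · rw [F.adT_comb]
    module
  · rw [F.adT_comb]
    module
  · rw [F.adT_comb, sq_abs]
    module

theorem exists_unstable_of_isotropic (F : L.IsMilnorFrame p q r c n₀ n₁ n₂ β₀ β₁ β₂)
    (h : n₀ = n₁) (h' : n₁ = n₂) (hβ : β₂ ≠ 0) :
    ∃ X : g, L.IsStationary X ∧ ¬ L.IsStable X := by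
  subst h h'
  refine L.exists_unstable_of_rotation
    (X := (0 : ℝ) • p + (0 : ℝ) • q + (0 : ℝ) • r + (1 : ℝ) • c)
    (P := β₂ • p + (0 : ℝ) • q + (-β₀) • r + (0 : ℝ) • c)
    (Q := (-(β₀ * β₁)) • p + (β₂ ^ 2 + β₀ ^ 2) • q + (-(β₁ * β₂)) • r + (0 : ℝ) • c)
    (ω := √(β₀ ^ 2 + β₁ ^ 2 + β₂ ^ 2)) (Real.sqrt_pos.2 (by positivity))
    (F.comb_ne_zero (by positivity)) ?_ ?_ ?_ ?_ ?_ ?_ <;> rw [F.adT_comb]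
  · module
  · module
  · module
  · rw [F.adT_comb]
    module
  · rw [F.adT_comb]
    module
  · rw [F.adT_comb, Real.sq_sqrt (by positivity)]
    module

theorem adT_eq_neg_ad (F : L.IsMilnorFrame p q r c n₀ n₁ n₂ β₀ β₁ β₂)
    (h : n₀ = n₁) (h' : n₁ = n₂) (hβ₀ : β₀ = 0) (hβ₁ : β₁ = 0) (hβ₂ : β₂ = 0) (x : g) :
    L.adT x = -L.ad x := by
  subst h h' hβ₀ hβ₁ hβ₂
  ext y
  obtain ⟨x₀, x₁, x₂, k, rfl⟩ := F.exists_eq x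
  obtain ⟨y₀, y₁, y₂, l, rfl⟩ := F.exists_eq y
  rw [F.adT_comb, LinearMap.neg_apply, ad, F.bracket_comb]
  module

theorem exists_unstable (F : L.IsMilnorFrame p q r c n₀ n₁ n₂ β₀ β₁ β₂)
    (hL : ∃ x : g, L.adT x ≠ -L.ad x) : ∃ X : g, L.IsStationary X ∧ ¬ L.IsStable X := by
  obtain ⟨x, hx⟩ := hL
  by_cases h₀₁ : n₀ = n₁
  · by_cases h₁₂ : n₁ = n₂
    · by_cases hβ₂ : β₂ = 0
      · by_cases hβ₀ : β₀ = 0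
        · have hβ₁ : β₁ ≠ 0 := fun hβ₁ => hx (F.adT_eq_neg_ad h₀₁ h₁₂ hβ₀ hβ₁ hβ₂ x)
          exact F.rotate.rotate.exists_unstable_of_isotropic (h₀₁.trans h₁₂).symm h₀₁ hβ₁
        · exact F.rotate.exists_unstable_of_isotropic h₁₂ (h₀₁.trans h₁₂).symm hβ₀
      · exact F.exists_unstable_of_isotropic h₀₁ h₁₂ hβ₂
    · exact F.exists_unstable_of_symmetric h₀₁ h₁₂
  by_cases h₁₂ : n₁ = n₂
  · exact F.rotate.exists_unstable_of_symmetric h₁₂ fun h => h₀₁ (h₁₂.trans h).symm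
  by_cases h₂₀ : n₂ = n₀
  · exact F.rotate.rotate.exists_unstable_of_symmetric h₂₀ h₀₁
  by_cases H₁ : 0 < (n₁ - n₂) * (n₀ - n₁)
  · exact F.exists_unstable_of_intermediate H₁
  by_cases H₂ : 0 < (n₂ - n₀) * (n₁ - n₂)
  · exact F.rotate.exists_unstable_of_intermediate H₂
  refine F.rotate.rotate.exists_unstable_of_intermediate ?_
  have e₁ : (n₁ - n₂) * (n₀ - n₁) < 0 := lt_of_le_of_ne (not_lt.1 H₁)
    (mul_ne_zero (sub_ne_zero.2 h₁₂) (sub_ne_zero.2 h₀₁))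
  have e₂ : (n₂ - n₀) * (n₁ - n₂) < 0 := lt_of_le_of_ne (not_lt.1 H₂)
    (mul_ne_zero (sub_ne_zero.2 h₂₀) (sub_ne_zero.2 h₁₂))
  nlinarith [mul_pos_of_neg_of_neg e₁ e₂, sq_nonneg (n₁ - n₂)]

end IsMilnorFrame

theorem IsUnimodular.exists_isMilnorFrame (hL : L.IsUnimodular) (hdim : Module.finrank ℝ g = 4)
    {c : g} (hc : ‖c‖ = 1) (hcen : ∀ x, L.bracket c x = 0) :
    ∃ (p q r : g) (n₀ n₁ n₂ β₀ β₁ β₂ : ℝ), L.IsMilnorFrame p q r c n₀ n₁ n₂ β₀ β₁ β₂ := by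
  obtain ⟨b, rfl⟩ := exists_orthonormalBasis_apply_three_eq hdim hc
  have hcen' : ∀ x, L.bracket x (b 3) = 0 := fun x => by rw [bracket_swap, hcen, neg_zero]
  have htr : ∀ x, ⟪b 0, L.bracket x (b 0)⟫_ℝ + ⟪b 1, L.bracket x (b 1)⟫_ℝ +
      ⟪b 2, L.bracket x (b 2)⟫_ℝ = 0 := fun x => by
    have := hL x
    rw [LinearMap.trace_eq_sum_inner _ b, Fin.sum_univ_four] at this
    simp only [ad] at this
    rwa [hcen', inner_zero_right, add_zero] at this
  let w : Fin 3 → g := ![L.bracket (b 1) (b 2), L.bracket (b 2) (b 0), L.bracket (b 0) (b 1)]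
  let M : Matrix (Fin 3) (Fin 3) ℝ := Matrix.of fun i j => ⟪b i.castSucc, w j⟫_ℝ
  have h₀ := htr (b 0)
  have h₁ := htr (b 1)
  have h₂ := htr (b 2)
  simp only [L.bracket_self, inner_zero_right] at h₀ h₁ h₂
  rw [L.bracket_swap (b 0) (b 2), inner_neg_right] at h₀
  rw [L.bracket_swap (b 1) (b 0), inner_neg_right] at h₁
  rw [L.bracket_swap (b 2) (b 1), inner_neg_right] at h₂
  have hsymm : M 0 1 = M 1 0 ∧ M 0 2 = M 2 0 ∧ M 1 2 = M 2 1 := by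
    have e₀ : M 0 1 = ⟪b 0, L.bracket (b 2) (b 0)⟫_ℝ := rfl
    have e₁ : M 1 0 = ⟪b 1, L.bracket (b 1) (b 2)⟫_ℝ := rfl
    have e₂ : M 0 2 = ⟪b 0, L.bracket (b 0) (b 1)⟫_ℝ := rfl
    have e₃ : M 2 0 = ⟪b 2, L.bracket (b 1) (b 2)⟫_ℝ := rfl
    have e₄ : M 1 2 = ⟪b 1, L.bracket (b 0) (b 1)⟫_ℝ := rfl
    have e₅ : M 2 1 = ⟪b 2, L.bracket (b 2) (b 0)⟫_ℝ := rfl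
    rw [e₀, e₁, e₂, e₃, e₄, e₅]
    refine ⟨?_, ?_, ?_⟩ <;> linarith
  obtain ⟨hM₀, hM₁, hM₂⟩ := hsymm
  have hM : M.IsHermitian := by
    refine Matrix.IsHermitian.ext fun i j => ?_
    fin_cases i <;> fin_cases j <;> simp [hM₀, hM₁, hM₂]
  let u : Fin 3 → Fin 3 → ℝ := fun i => hM.eigenvectorBasis i
  let P : Fin 3 → g := fun i => u i 0 • b 0 + u i 1 • b 1 + u i 2 • b 2
  have hu : ∀ i j, u i 0 * u j 0 + u i 1 * u j 1 + u i 2 * u j 2 = if i = j then 1 else 0 := by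
    intro i j
    have := orthonormal_iff_ite.1 hM.eigenvectorBasis.orthonormal i j
    rw [← this, PiLp.inner_apply, Fin.sum_univ_three]
    simp only [RCLike.inner_apply, conj_trivial, u]
    ring
  have heig : ∀ i j, M j 0 * u i 0 + M j 1 * u i 1 + M j 2 * u i 2 =
      hM.eigenvalues i * u i j := by
    intro i j
    have := congrFun (hM.mulVec_eigenvectorBasis i) j
    simpa [Matrix.mulVec, dotProduct, Fin.sum_univ_three] using this
  have hb := orthonormal_iff_ite.1 b.orthonormal
  have hPP : ∀ i j, ⟪P i, P j⟫_ℝ = if i = j then 1 else 0 := by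
    intro i j
    rw [← hu i j]
    simp only [P, inner_add_left, inner_add_right, real_inner_smul_left, real_inner_smul_right, hb]
    simp
    ring
  have hPb : ∀ i, ⟪P i, b 3⟫_ℝ = 0 := by
    intro i
    simp only [P, inner_add_left, real_inner_smul_left, hb]
    simp
  have hPn : ∀ i, ‖P i‖ = 1 := fun i => by
    rw [norm_eq_sqrt_real_inner, hPP, if_pos rfl, Real.sqrt_one]
  have ho : Orthonormal ℝ ![P 0, P 1, P 2, b 3] := by
    rw [orthonormal_iff_ite]
    intro i j
    fin_cases i <;> fin_cases j <;> simp [hPP, hPb, hPn, real_inner_comm _ (b 3)]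
  let B := OrthonormalBasis.mk ho
    (ho.linearIndependent.span_eq_top_of_card_eq_finrank' (by simp [hdim])).ge
  have hB : ∀ z, z = ⟪P 0, z⟫_ℝ • P 0 + ⟪P 1, z⟫_ℝ • P 1 + ⟪P 2, z⟫_ℝ • P 2 +
      ⟪b 3, z⟫_ℝ • b 3 := by
    intro z
    have := B.sum_repr' z
    rw [Fin.sum_univ_four] at this
    simpa [B] using this.symm
  have hPw : ∀ k l, ⟪P k, w l⟫_ℝ = hM.eigenvalues k * u k l := by
    intro k l
    rw [← heig k l, ← hM.apply l 0, ← hM.apply l 1, ← hM.apply l 2]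
    simp only [P, inner_add_left, real_inner_smul_left, star_trivial]
    change u k 0 * M 0 l + u k 1 * M 1 l + u k 2 * M 2 l = _
    ring
  have hPbr : ∀ i j, L.bracket (P i) (P j) = (u i 1 * u j 2 - u i 2 * u j 1) • w 0 +
      (u i 2 * u j 0 - u i 0 * u j 2) • w 1 + (u i 0 * u j 1 - u i 1 * u j 0) • w 2 := by
    intro i j
    have e₀ : w 0 = L.bracket (b 1) (b 2) := rfl
    have e₁ : w 1 = L.bracket (b 2) (b 0) := rfl
    have e₂ : w 2 = L.bracket (b 0) (b 1) := rfl
    simp only [P, e₀, e₁, e₂, map_add, map_smul, LinearMap.add_apply, LinearMap.smul_apply,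
      L.bracket_self, L.bracket_swap (b 2) (b 1), L.bracket_swap (b 1) (b 0),
      L.bracket_swap (b 0) (b 2)]
    module
  have hPPP : ∀ k i j, ⟪P k, L.bracket (P i) (P j)⟫_ℝ = hM.eigenvalues k *
      ((u i 1 * u j 2 - u i 2 * u j 1) * u k 0 + (u i 2 * u j 0 - u i 0 * u j 2) * u k 1 +
        (u i 0 * u j 1 - u i 1 * u j 0) * u k 2) := by
    intro k i j
    rw [hPbr]
    simp only [inner_add_right, real_inner_smul_right, hPw]
    ring
  have hl : ∀ i j, ⟪P i, L.bracket (P i) (P j)⟫_ℝ = 0 := fun i j => by rw [hPPP]; ring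
  have hr : ∀ i j, ⟪P j, L.bracket (P i) (P j)⟫_ℝ = 0 := fun i j => by rw [hPPP]; ring
  refine ⟨P 0, P 1, P 2, ⟪P 0, L.bracket (P 1) (P 2)⟫_ℝ, ⟪P 1, L.bracket (P 2) (P 0)⟫_ℝ,
    ⟪P 2, L.bracket (P 0) (P 1)⟫_ℝ, ⟪b 3, L.bracket (P 1) (P 2)⟫_ℝ,
    ⟪b 3, L.bracket (P 2) (P 0)⟫_ℝ, ⟪b 3, L.bracket (P 0) (P 1)⟫_ℝ, ho,
    fun z => ⟨_, _, _, _, hB z⟩, ?_, ?_, ?_, hcen⟩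
  · refine (hB _).trans ?_
    rw [hl, hr]
    module
  · refine (hB _).trans ?_
    rw [hl, hr]
    module
  · refine (hB _).trans ?_
    rw [hl, hr]
    module

end LieStructure

/-- A 4-dimensional unimodular metric Lie algebra whose inner product is not
bi-invariant has an unstable stationary point. -/
theorem exists_unstable_stationary_dim4    {g : Type*} [NormedAddCommGroup g] [InnerProductSpace ℝ g] [FiniteDimensional ℝ g]
    (L : LieStructure g) (hdim : Module.finrank ℝ g = 4)
    (huni : L.IsUnimodular)
    (hnotbi : ∃ X₀ : g, L.adT X₀ ≠ -(L.ad X₀)) :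
    ∃ X : g, L.IsStationary X ∧ ¬ L.IsStable X := by
  by_cases hcen : ∃ c : g, c ≠ 0 ∧ ∀ x, L.bracket c x = 0
  · obtain ⟨c, hc0, hc⟩ := hcen
    obtain ⟨p, q, r, n₀, n₁, n₂, β₀, β₁, β₂, F⟩ :=
      huni.exists_isMilnorFrame hdim (c := ‖c‖⁻¹ • c)
        (by rw [norm_smul, norm_inv, norm_norm, inv_mul_cancel₀ (norm_ne_zero_iff.2 hc0)])
        fun x => by rw [map_smul, LinearMap.smul_apply, hc, smul_zero]
    exact F.exists_unstable hnotbi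
  · push Not at hcen
    obtain ⟨c, hc0, hc⟩ | ⟨e, he, hcomm⟩ := huni.exists_central_or_abelian_hyperplane hdim
    · obtain ⟨x, hx⟩ := hcen c hc0
      exact (hx (hc x)).elim
    · exact LieStructure.exists_unstable_of_abelian_hyperplane huni hdim hcen he hcomm
end

section
/- Let (g,⟨·,·⟩) be a metric Lie algebra. Then for every X ∈ g, Tr J_X = Tr ad_X. -/
open scoped InnerProductSpace

/-- Lemma 2.1 (a), first part: `Tr J_X = Tr ad_X`. -/
theorem trace_J_eq_trace_ad    {g : Type*} [NormedAddCommGroup g] [InnerProductSpace ℝ g] [FiniteDimensional ℝ g]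
    (L : LieStructure g) (X : g) :
    LinearMap.trace ℝ g (L.J X) = LinearMap.trace ℝ g (L.ad X) := by
  let b := stdOrthonormalBasis ℝ g
  rw [LinearMap.trace_eq_sum_inner _ b, LinearMap.trace_eq_sum_inner _ b]
  refine Finset.sum_congr rfl fun i _ => ?_
  change ⟪b i, L.adT X (b i) + L.adT (b i) X⟫_ℝ = _
  have h : L.ad (b i) (b i) = 0 := L.bracket_self (b i)
  rw [inner_add_right, LieStructure.adT, LieStructure.adT, LinearMap.adjoint_inner_right,
    LinearMap.adjoint_inner_right, h, inner_zero_left, add_zero, real_inner_comm]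
end

section
/- Let (g,⟨·,·⟩) be a metric Lie algebra and let X ∈ g be a stable stationary point of the Euler equation. Then Tr ad_X ≤ 0. -/
open scoped InnerProductSpace

/-- A bounded and globally Lipschitz vector field has global integral curves. -/
theorem exists_forall_hasDerivAt_of_lipschitzWith_of_bounded {E : Type*} [NormedAddCommGroup E]
    [NormedSpace ℝ E] [CompleteSpace E] {f : E → E} {K M : NNReal} (hf : LipschitzWith K f)
    (hM : ∀ x, ‖f x‖ ≤ M) (x₀ : E) :
    ∃ α : ℝ → E, α 0 = x₀ ∧ ∀ t, HasDerivAt α (f (α t)) t := by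
  have hloc (n : ℕ) : ∃ α : ℝ → E, α 0 = x₀ ∧
      ∀ t ∈ Set.Ioo (-((n : ℝ) + 1)) (n + 1), HasDerivAt α (f (α t)) t := by
    have hn : (0 : ℝ) ≤ n + 1 := by positivity
    have h0 : (0 : ℝ) ∈ Set.Icc (-((n : ℝ) + 1)) (n + 1) := ⟨by linarith, hn⟩
    have hpl : IsPicardLindelof (fun _ ↦ f) ⟨0, h0⟩ x₀ (M * (n + 1)) 0 M K := by
      refine .of_time_independent (fun x _ ↦ hM x) hf.lipschitzOnWith ?_
      simp
    obtain ⟨α, hα0, hα⟩ := hpl.exists_eq_forall_mem_Icc_hasDerivWithinAt₀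
    exact ⟨α, hα0, fun t ht ↦
      (hα t (Set.Ioo_subset_Icc_self ht)).hasDerivAt (Icc_mem_nhds ht.1 ht.2)⟩
  choose α hα0 hα using hloc
  have hcomp (m n : ℕ) (t : ℝ) (hm : |t| < m + 1) (hn : |t| < n + 1) : α m t = α n t := by
    wlog hmn : m ≤ n generalizing m n
    · exact (this n m hn hm (le_of_not_ge hmn)).symm
    have hmn' : (m : ℝ) ≤ n := by exact_mod_cast hmn
    have hsub : Set.Ioo (-((m : ℝ) + 1)) (m + 1) ⊆ Set.Ioo (-((n : ℝ) + 1)) (n + 1) :=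
      Set.Ioo_subset_Ioo (by linarith) (by linarith)
    have h0 : (0 : ℝ) ∈ Set.Ioo (-((m : ℝ) + 1)) (m + 1) := by
      constructor <;> linarith [(Nat.cast_nonneg m : (0 : ℝ) ≤ m)]
    exact ODE_solution_unique_of_mem_Ioo (v := fun _ ↦ f) (s := fun _ ↦ Set.univ)
      (fun _ _ ↦ hf.lipschitzOnWith) h0 (fun t ht ↦ ⟨hα m t ht, trivial⟩)
      (fun t ht ↦ ⟨hα n t (hsub ht), trivial⟩) ((hα0 m).trans (hα0 n).symm) (abs_lt.mp hm)
  have hlt (t : ℝ) : |t| < (⌈|t|⌉₊ : ℝ) + 1 := (Nat.le_ceil _).trans_lt (lt_add_one _)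
  refine ⟨fun t ↦ α ⌈|t|⌉₊ t, hα0 _, fun t ↦ ?_⟩
  refine (hα ⌈|t|⌉₊ t (abs_lt.mp (hlt t))).congr_of_eventuallyEq ?_
  filter_upwards [Ioo_mem_nhds (abs_lt.mp (hlt t)).1 (abs_lt.mp (hlt t)).2] with s hs
  exact hcomp _ _ s (hlt s) (abs_lt.mpr hs)

/-- A `C¹` vector field tangent to all spheres centred at the origin has global integral curves. -/
theorem exists_forall_hasDerivAt_of_inner_self_eq_zero {E : Type*} [NormedAddCommGroup E]
    [InnerProductSpace ℝ E] [FiniteDimensional ℝ E] {f : E → E} (hf : ContDiff ℝ 1 f)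
    (htan : ∀ x, ⟪x, f x⟫_ℝ = 0) (x₀ : E) :
    ∃ α : ℝ → E, α 0 = x₀ ∧ ∀ t, HasDerivAt α (f (α t)) t := by
  let χ : ContDiffBump (0 : E) := ⟨‖x₀‖ + 1, ‖x₀‖ + 2, by positivity, by linarith⟩
  have hsmooth : ContDiff ℝ 1 (fun x ↦ χ x • f x) := χ.contDiff.smul hf
  have hsupp : HasCompactSupport (fun x ↦ χ x • f x) := χ.hasCompactSupport.smul_right
  obtain ⟨K, hK⟩ := ContDiff.lipschitzWith_of_hasCompactSupport hsupp hsmooth one_ne_zero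
  obtain ⟨M, hM⟩ := hsupp.exists_bound_of_continuous hsmooth.continuous
  obtain ⟨α, hα0, hα⟩ := exists_forall_hasDerivAt_of_lipschitzWith_of_bounded (M := M.toNNReal) hK
    (fun x ↦ (hM x).trans (Real.le_coe_toNNReal M)) x₀
  have hnorm (t : ℝ) : ⟪α t, α t⟫_ℝ = ⟪α 0, α 0⟫_ℝ := by
    have hd (s : ℝ) : HasDerivAt (fun s ↦ ⟪α s, α s⟫_ℝ) 0 s := by
      refine ((hα s).inner ℝ (hα s)).congr_deriv ?_
      rw [real_inner_comm, real_inner_smul_left, real_inner_comm, htan]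
      simp
    exact is_const_of_deriv_eq_zero (fun s ↦ (hd s).differentiableAt) (fun s ↦ (hd s).deriv) t 0
  refine ⟨α, hα0, fun t ↦ (hα t).congr_deriv ?_⟩
  have hball : α t ∈ Metric.closedBall (0 : E) χ.rIn := by
    have h := hnorm t
    rw [real_inner_self_eq_norm_sq, real_inner_self_eq_norm_sq, hα0,
      sq_eq_sq₀ (norm_nonneg _) (norm_nonneg _)] at h
    rw [mem_closedBall_zero_iff, h]
    exact (lt_add_one _).le
  rw [χ.one_of_mem_closedBall hball, one_smul]

/-- An endomorphism with positive trace admits a quadratic form which grows along its flow and is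
positive somewhere. -/
theorem LinearMap.exists_isSymmetric_of_trace_pos {E : Type*} [NormedAddCommGroup E]
    [InnerProductSpace ℝ E] [FiniteDimensional ℝ E] (A : E →ₗ[ℝ] E)
    (hA : 0 < LinearMap.trace ℝ E A) :
    ∃ (c : ℝ) (S : E →ₗ[ℝ] E), 0 < c ∧ S.IsSymmetric ∧
      (∀ y, 2 * ⟪S y, A y⟫_ℝ = c * ⟪S y, y⟫_ℝ + 2 * ‖y‖ ^ 2) ∧ ∃ v, 0 < ⟪S v, v⟫_ℝ := by
  let T : Module.End ℝ (Module.End ℝ E) :=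
    LinearMap.mulLeft ℝ (LinearMap.adjoint A) + LinearMap.mulRight ℝ A
  let n := Module.finrank ℝ E
  have hbound : 0 < 2 * LinearMap.trace ℝ E A / (n + 1) := by positivity
  obtain ⟨c, ⟨hc0, hc⟩, hcT⟩ :=
    ((Set.Ioo_infinite hbound).sdiff (Module.End.finite_spectrum T)).nonempty
  have hunit := spectrum.notMem_iff.mp hcT
  obtain ⟨B, hB⟩ := ((Module.End.isUnit_iff _).mp hunit).surjective (-1)
  have hB' (y : E) : LinearMap.adjoint A (B y) + B (A y) = c • B y + y := by
    have h := LinearMap.congr_fun hB y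
    simp only [T, Module.algebraMap_end_eq_smul_id, LinearMap.sub_apply, LinearMap.smul_apply,
      LinearMap.id_apply, LinearMap.add_apply, LinearMap.mulLeft_apply,
      LinearMap.mulRight_apply, Module.End.mul_apply, LinearMap.neg_apply,
      Module.End.one_apply] at h
    rw [sub_eq_iff_eq_add] at h
    rw [h]
    abel
  let S : E →ₗ[ℝ] E := B + LinearMap.adjoint B
  have hS : S.IsSymmetric := fun x y ↦ by
    simp only [S, LinearMap.add_apply, inner_add_left, inner_add_right,
      LinearMap.adjoint_inner_left, LinearMap.adjoint_inner_right]
    ring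
  have hSA (y : E) : 2 * ⟪S y, A y⟫_ℝ = c * ⟪S y, y⟫_ℝ + 2 * ‖y‖ ^ 2 := by
    have h := congrArg (fun z ↦ ⟪z, y⟫_ℝ) (hB' y)
    simp only [inner_add_left, real_inner_smul_left, LinearMap.adjoint_inner_left,
      real_inner_self_eq_norm_sq] at h
    simp only [S, LinearMap.add_apply, inner_add_left, LinearMap.adjoint_inner_left]
    rw [real_inner_comm (B (A y)) y, real_inner_comm (B y) y]
    linarith
  refine ⟨c, S, hc0, hS, hSA, ?_⟩
  let b := hS.eigenvectorBasis (rfl : Module.finrank ℝ E = n)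
  obtain ⟨i, hi⟩ : ∃ i, c / 2 < ⟪b i, A (b i)⟫_ℝ := by
    by_contra! h
    have hsum := Finset.sum_le_sum fun i (_ : i ∈ Finset.univ) ↦ h i
    rw [← LinearMap.trace_eq_sum_inner A b, Finset.sum_const, Finset.card_univ,
      Fintype.card_fin, nsmul_eq_mul] at hsum
    rw [lt_div_iff₀ (by positivity)] at hc
    linarith
  refine ⟨b i, ?_⟩
  have hb : S (b i) = hS.eigenvalues rfl i • b i := hS.apply_eigenvectorBasis rfl i
  have h := hSA (b i)
  rw [hb, real_inner_smul_left, real_inner_smul_left, real_inner_self_eq_norm_sq,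
    b.norm_eq_one] at h
  rw [hb, real_inner_smul_left, real_inner_self_eq_norm_sq, b.norm_eq_one]
  have hprod : 0 < hS.eigenvalues rfl i * (⟪b i, A (b i)⟫_ℝ - c / 2) := by linarith
  linarith [pos_of_mul_pos_left hprod (sub_pos.mpr hi).le]

namespace LieStructure

variable {g : Type*} [NormedAddCommGroup g] [InnerProductSpace ℝ g] [FiniteDimensional ℝ g]
variable (L : LieStructure g)

/-- The bilinear map `(Y, Z) ↦ ad_Yᵗ Z`. -/
noncomputable def adTBilin : g →ₗ[ℝ] g →ₗ[ℝ] g :=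
  LinearMap.mk₂ ℝ (fun Y Z ↦ L.adT Y Z)
    (fun Y Y' Z ↦ by simp [adT, ad])
    (fun c Y Z ↦ by simp [adT, ad])
    (fun Y Z Z' ↦ by simp)
    (fun c Y Z ↦ by simp)

theorem inner_adT_self (Y : g) : ⟪Y, L.adT Y Y⟫_ℝ = 0 := by
  rw [adT, LinearMap.adjoint_inner_right, ad, L.bracket_self, inner_zero_left]

theorem contDiff_adT_self : ContDiff ℝ 1 fun Y : g ↦ L.adT Y Y :=
  L.adTBilin.toContinuousBilinearMap.contDiff.clm_apply contDiff_id

theorem exists_isSolution (Y₀ : g) : ∃ Y : ℝ → g, Y 0 = Y₀ ∧ L.IsSolution Y :=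
  exists_forall_hasDerivAt_of_inner_self_eq_zero L.contDiff_adT_self L.inner_adT_self Y₀

theorem exists_norm_adT_self_le : ∃ C, 0 ≤ C ∧ ∀ Y, ‖L.adT Y Y‖ ≤ C * ‖Y‖ ^ 2 :=
  ⟨‖L.adTBilin.toContinuousBilinearMap‖, ContinuousLinearMap.opNorm_nonneg _, fun Y ↦ by
    rw [pow_two, ← mul_assoc]
    exact L.adTBilin.toContinuousBilinearMap.le_opNorm₂ Y Y⟩

theorem adT_add_self {X : g} (hX : L.IsStationary X) (Z : g) :
    L.adT (X + Z) (X + Z) = L.J X Z + L.adT Z Z := by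
  have hX' : L.adTBilin X X = 0 := hX
  change L.adTBilin (X + Z) (X + Z) = L.adTBilin X Z + L.adTBilin Z X + L.adTBilin Z Z
  simp only [map_add, LinearMap.add_apply, hX']
  abel

/-- The linearisation `J_X` and `ad_X` have the same trace. -/
theorem trace_J (X : g) : LinearMap.trace ℝ g (L.J X) = LinearMap.trace ℝ g (L.ad X) := by
  let b := stdOrthonormalBasis ℝ g
  rw [LinearMap.trace_eq_sum_inner _ b, LinearMap.trace_eq_sum_inner _ b]
  refine Finset.sum_congr rfl fun i _ ↦ ?_
  change ⟪b i, L.adT X (b i) + L.adT (b i) X⟫_ℝ = _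
  rw [inner_add_right, adT, adT, LinearMap.adjoint_inner_right, LinearMap.adjoint_inner_right, ad,
    ad, L.bracket_self, inner_zero_left, add_zero, real_inner_comm]

end LieStructure

/-- Lemma 2.1 (a), second part: a stable stationary point has `Tr ad_X ≤ 0`. -/
theorem trace_ad_nonpos_of_stable    {g : Type*} [NormedAddCommGroup g] [InnerProductSpace ℝ g] [FiniteDimensional ℝ g]
    (L : LieStructure g)
    (X : g) (hX : L.IsStationary X) (hstable : L.IsStable X) :
    LinearMap.trace ℝ g (L.ad X) ≤ 0 := by
  by_contra! htr
  rw [← L.trace_J] at htr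
  obtain ⟨c, S, hc, hS, hSJ, v, hv⟩ := (L.J X).exists_isSymmetric_of_trace_pos htr
  obtain ⟨C, hC, hCbound⟩ := L.exists_norm_adT_self_le
  let N := ‖S.toContinuousLinearMap‖
  have hN : 0 ≤ N := norm_nonneg _
  have hSN (y : g) : ‖S y‖ ≤ N * ‖y‖ := S.toContinuousLinearMap.le_opNorm y
  let ε := 1 / (N * C + 1)
  have hε : 0 < ε := by positivity
  have hεle : N * C * ε ≤ 1 := by
    rw [mul_one_div, div_le_one (by positivity)]
    linarith
  obtain ⟨δ, hδ, hstab⟩ := hstable ε hε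
  let s := δ / (‖v‖ + 1)
  have hs : 0 < s := by positivity
  obtain ⟨Y, hY0, hY⟩ := L.exists_isSolution (X + s • v)
  let y : ℝ → g := fun t ↦ Y t - X
  have hy0 : y 0 = s • v := by simp [y, hY0]
  have hsmall : ∀ t ≥ 0, ‖y t‖ < ε := by
    refine hstab Y hY ?_
    change ‖y 0‖ < δ
    rw [hy0, norm_smul, Real.norm_of_nonneg hs.le, div_mul_eq_mul_div,
      div_lt_iff₀ (by positivity)]
    nlinarith
  have hy (t : ℝ) : HasDerivAt y (L.J X (y t) + L.adT (y t) (y t)) t := by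
    have h := (hY t).sub_const X
    rwa [show Y t = X + y t by simp [y], L.adT_add_self hX] at h
  let V : ℝ → ℝ := fun t ↦ ⟪S (y t), y t⟫_ℝ
  have hV (t : ℝ) : HasDerivAt V
      (c * V t + 2 * (‖y t‖ ^ 2 + ⟪S (y t), L.adT (y t) (y t)⟫_ℝ)) t := by
    refine ((S.toContinuousLinearMap.hasFDerivAt.comp_hasDerivAt t (hy t)).inner ℝ
      (hy t)).congr_deriv ?_
    simp only [LinearMap.coe_toContinuousLinearMap', Function.comp_apply]
    rw [hS (L.J X (y t) + _), real_inner_comm, ← two_mul, real_inner_comm, inner_add_right]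
    have h := hSJ (y t)
    simp only [V]
    linarith
  have hW (t : ℝ) : HasDerivAt (fun t ↦ Real.exp (-c * t) * V t)
      (Real.exp (-c * t) * (2 * (‖y t‖ ^ 2 + ⟪S (y t), L.adT (y t) (y t)⟫_ℝ))) t := by
    have hexp : HasDerivAt (fun t ↦ Real.exp (-c * t)) (Real.exp (-c * t) * (-c)) t := by
      simpa using ((hasDerivAt_id t).const_mul (-c)).exp
    refine (hexp.mul (hV t)).congr_deriv ?_
    ring
  have hnonneg : ∀ t ≥ 0, 0 ≤ ‖y t‖ ^ 2 + ⟪S (y t), L.adT (y t) (y t)⟫_ℝ := fun t ht ↦ by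
    have hle : ‖S (y t)‖ * ‖L.adT (y t) (y t)‖ ≤ ‖y t‖ ^ 2 := calc
      _ ≤ (N * ‖y t‖) * (C * ‖y t‖ ^ 2) := by
        gcongr
        exacts [hSN _, hCbound _]
      _ = (N * C * ‖y t‖) * ‖y t‖ ^ 2 := by ring
      _ ≤ 1 * ‖y t‖ ^ 2 := by
        gcongr
        exact (mul_le_mul_of_nonneg_left (hsmall t ht).le (by positivity)).trans hεle
      _ = _ := one_mul _
    linarith [neg_le_of_abs_le (abs_real_inner_le_norm (S (y t)) (L.adT (y t) (y t)))]
  have hmono : MonotoneOn (fun t ↦ Real.exp (-c * t) * V t) (Set.Ici 0) := by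
    refine monotoneOn_of_deriv_nonneg (convex_Ici 0)
      (fun t _ ↦ (hW t).continuousAt.continuousWithinAt)
      (fun t _ ↦ (hW t).differentiableAt.differentiableWithinAt) fun t ht ↦ ?_
    rw [interior_Ici] at ht
    rw [(hW t).deriv]
    have := hnonneg t (le_of_lt ht)
    positivity
  have hV0 : 0 < V 0 := by
    simp only [V, hy0, map_smul, real_inner_smul_left, real_inner_smul_right]
    positivity
  have hupper : ∀ t ≥ 0, V 0 ≤ Real.exp (-c * t) * (N * ε ^ 2) := fun t ht ↦ calc
    V 0 ≤ Real.exp (-c * t) * V t := by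
      simpa using hmono (Set.mem_Ici.mpr le_rfl) (Set.mem_Ici.mpr ht) ht
    _ ≤ Real.exp (-c * t) * (N * ε ^ 2) := by
      gcongr
      calc V t ≤ ‖S (y t)‖ * ‖y t‖ := real_inner_le_norm _ _
        _ ≤ N * ‖y t‖ * ‖y t‖ := by
          gcongr
          exact hSN _
        _ = N * ‖y t‖ ^ 2 := by ring
        _ ≤ N * ε ^ 2 := by
          gcongr
          exact (hsmall t ht).le
  have hlim : Filter.Tendsto (fun t ↦ Real.exp (-c * t) * (N * ε ^ 2)) Filter.atTop (nhds 0) := by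
    have h := (Real.tendsto_exp_atBot.comp (Filter.tendsto_id.const_mul_atTop_of_neg
      (neg_lt_zero.mpr hc))).mul_const (N * ε ^ 2)
    simpa using h
  exact hV0.not_ge (ge_of_tendsto hlim (Filter.eventually_atTop.mpr ⟨0, hupper⟩))
end

section
/- Let V be a 3-dimensional real vector space and A : V → V a linear operator with Tr A = 0 and det A ≠ 0. Then every complex root of the characteristic polynomial of A has nonzero real part. -/
/-- Lemma 4.1 (i): a traceless invertible operator on a 3-dimensional real vector space
has no eigenvalue with zero real part. -/
theorem no_purely_imaginary_eigenvalue
    {V : Type*} [AddCommGroup V] [Module ℝ V] [Module.Finite ℝ V]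
    (hdim : Module.finrank ℝ V = 3) (A : V →ₗ[ℝ] V)
    (htr : LinearMap.trace ℝ V A = 0) (hdet : LinearMap.det A ≠ 0) :
    ∀ z : ℂ, (Polynomial.map (algebraMap ℝ ℂ) (LinearMap.charpoly A)).IsRoot z →
      z.re ≠ 0 := by
  intro z hz hre
  have hdeg : A.charpoly.natDegree = 3 := by rw [LinearMap.charpoly_natDegree, hdim]
  have coeff_three : A.charpoly.coeff 3 = 1 := by
    rw [← hdeg]
    exact A.charpoly_monic.coeff_natDegree
  have coeff_two : A.charpoly.coeff 2 = 0 := by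
    let b := Module.finBasisOfFinrankEq ℝ V hdim
    rw [LinearMap.trace_eq_matrix_trace ℝ b, Matrix.trace_eq_neg_charpoly_coeff,
      LinearMap.charpoly_toMatrix] at htr
    simpa using htr
  have coeff_zero : A.charpoly.coeff 0 ≠ 0 := by
    intro h
    rw [LinearMap.det_eq_sign_charpoly_coeff, h, mul_zero] at hdet
    exact hdet rfl
  rw [Polynomial.IsRoot.def, Polynomial.eval_map, Polynomial.eval₂_eq_sum_range, hdeg] at hz
  have hz_re := congrArg Complex.re hz
  simp [Finset.sum_range_succ, coeff_three, coeff_two, hre, pow_succ] at hz_re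
  exact coeff_zero hz_re
end
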